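/- For natural numbers n ≥ 1 and m ≥ 2, the integrals N_{n,m} satisfy the recurrence (2n+1)·m·N_{n,m} = (2m−1)·(n+1)·N_{n+1,m−1} + (2m−1)·n·N_{n−1,m−1} − (2n+1)·(m−1)·N_{n,m−2}. -/

import Mathlib

open MeasureTheory Real

/-- The Legendre polynomials, defined by `P 0 x = 1`, `P 1 x = x` and the
three-term recurrence `(n+1) * P (n+1) x = (2*n+1) * x * P n x - n * P (n-1) x` for `n ≥ 1`. -/
noncomputable def legendreP : ℕ → ℝ → ℝ
  | 0, _ => 1
  | 1, x => x
  | (n + 2), x =>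
      ((2 * (n + 1 : ℝ) + 1) * x * legendreP (n + 1) x - (n + 1 : ℝ) * legendreP n x)
        / ((n + 1 : ℝ) + 1)

/-- `N n m = ∫₀¹ Pₙ(2x-1) Pₘ(2x-1) log x dx`. -/
noncomputable def N (n m : ℕ) : ℝ :=
  ∫ x in (0:ℝ)..1, legendreP n (2 * x - 1) * legendreP m (2 * x - 1) * Real.log x

theorem continuous_legendreP : ∀ n : ℕ, Continuous (legendreP n)
  | 0 => by
    simp only [funext fun x => legendreP.eq_1 x]
    exact continuous_const
  | 1 => by
    simp only [funext fun x => legendreP.eq_2 x]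
    exact continuous_id
  | (n + 2) => by
    have h₁ := continuous_legendreP (n + 1)
    have h₀ := continuous_legendreP n
    rw [funext fun x => legendreP.eq_3 x n]
    fun_prop

theorem legendreP_recurrence (n : ℕ) (x : ℝ) :
    ((n : ℝ) + 2) * legendreP (n + 2) x + ((n : ℝ) + 1) * legendreP n x =
      (2 * (n : ℝ) + 3) * x * legendreP (n + 1) x := by
  have h : (n : ℝ) + 1 + 1 ≠ 0 := by positivity
  rw [legendreP]
  field_simp
  ring

theorem intervalIntegrable_legendreP_mul_legendreP_mul_log (n m : ℕ) (a b : ℝ) :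
    IntervalIntegrable
      (fun x : ℝ => legendreP n (2 * x - 1) * legendreP m (2 * x - 1) * Real.log x) volume a b := by
  have hn := continuous_legendreP n
  have hm := continuous_legendreP m
  exact intervalIntegral.intervalIntegrable_log'.continuousOn_mul
    (Continuous.continuousOn (by fun_prop))

theorem stmt_8 (n m : ℕ) (hn : 1 ≤ n) (hm : 2 ≤ m) :
    (2 * (n : ℝ) + 1) * (m : ℝ) * N n m =
      (2 * (m : ℝ) - 1) * ((n : ℝ) + 1) * N (n + 1) (m - 1)
        + (2 * (m : ℝ) - 1) * (n : ℝ) * N (n - 1) (m - 1)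
        - (2 * (n : ℝ) + 1) * ((m : ℝ) - 1) * N n (m - 2) := by
  obtain ⟨j, rfl⟩ := Nat.exists_eq_add_of_le' hn
  obtain ⟨k, rfl⟩ := Nat.exists_eq_add_of_le' hm
  have hint := fun p q => intervalIntegrable_legendreP_mul_legendreP_mul_log p q 0 1
  simp only [Nat.add_sub_cancel, show k + 2 - 1 = k + 1 from rfl, N]
  simp only [← intervalIntegral.integral_const_mul]
  rw [← intervalIntegral.integral_add ((hint _ _).const_mul _) ((hint _ _).const_mul _),
    ← intervalIntegral.integral_sub
      (((hint _ _).const_mul _).add ((hint _ _).const_mul _)) ((hint _ _).const_mul _)]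
  refine intervalIntegral.integral_congr fun x _ => ?_
  have hj := legendreP_recurrence j (2 * x - 1)
  have hk := legendreP_recurrence k (2 * x - 1)
  push_cast
  linear_combination
    (2 * (j : ℝ) + 3) * legendreP (j + 1) (2 * x - 1) * Real.log x * hk
      - (2 * (k : ℝ) + 3) * legendreP (k + 1) (2 * x - 1) * Real.log x * hj
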